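/- arXiv:2211.01357 — 2 statements merged into one kernel-verified Lean document; each statement's English description precedes it below -/
import Mathlib

section
/- Assume ‖g_s‖ ≤ B for all 1 ≤ s ≤ T. Let 1 ≤ t ≤ T+1, C > 0, let x_t be the minimizer of Φ_t over int B(1), and let u ∈ int B(1) satisfy (u−x_t)ᵀ∇²Ψ(u)(u−x_t) ≤ ηC², where ∇²Ψ(u) = 2ηd·( I/(1−‖u‖²) + 2uuᵀ/(1−‖u‖²)² ). Then in the Loewner (positive semidefinite) order: ∇²Φ_t(u) ⪯ 7·(1+C)²·(2ηd + B²η + (B + 2βB²)(t−1))²·I. -/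
open Finset
open scoped InnerProductSpace

noncomputable section

/-- `Ψ(x) = −ηd·ln(1−‖x‖²)`, the scaled log-barrier of the Euclidean unit ball. -/
def Psi (d : ℕ) (η : ℝ) (x : EuclideanSpace ℝ (Fin d)) : ℝ :=
  -(η * d) * Real.log (1 - ‖x‖ ^ 2)

/-- The outer product `v wᵀ` of two vectors in `ℝ^d`. -/
def outer {d : ℕ} (v w : EuclideanSpace ℝ (Fin d)) : Matrix (Fin d) (Fin d) ℝ :=
  fun i j => v i * w j

/-- The Hessian of `Ψ`: `∇²Ψ(x) = 2ηd·( I/(1−‖x‖²) + 2xxᵀ/(1−‖x‖²)² )`. -/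
def hessPsi (d : ℕ) (η : ℝ) (x : EuclideanSpace ℝ (Fin d)) : Matrix (Fin d) (Fin d) ℝ :=
  (2 * η * d / (1 - ‖x‖ ^ 2)) • (1 : Matrix (Fin d) (Fin d) ℝ)
    + (4 * η * d / (1 - ‖x‖ ^ 2) ^ 2) • outer x x

/-- `Φ_t(x) = Ψ(x) + ((d+B²η)/2)‖x‖² + (β/2)·Σ_{s=1}^{t−1}⟪g_s, x−w_s⟫² + ⟪x, Σ_{s=1}^{t−1} g_s⟫`. -/
def Phi (d : ℕ) (η β B : ℝ) (g w : ℕ → EuclideanSpace ℝ (Fin d)) (t : ℕ)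
    (x : EuclideanSpace ℝ (Fin d)) : ℝ :=
  Psi d η x + ((d + B ^ 2 * η) / 2) * ‖x‖ ^ 2
    + (β / 2) * ∑ s ∈ Icc 1 (t - 1), ⟪g s, x - w s⟫_ℝ ^ 2
    + ⟪x, (∑ s ∈ Icc 1 (t - 1), g s)⟫_ℝ

/-- The Hessian of `Φ_t`:
`∇²Φ_t(x) = (2ηd/(1−‖x‖²))I + (4ηd/(1−‖x‖²)²)xxᵀ + (d+ηB²)I + β·Σ_{s=1}^{t−1} g_s g_sᵀ`. -/
def hessPhi (d : ℕ) (η β B : ℝ) (g : ℕ → EuclideanSpace ℝ (Fin d)) (t : ℕ)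
    (x : EuclideanSpace ℝ (Fin d)) : Matrix (Fin d) (Fin d) ℝ :=
  hessPsi d η x + ((d : ℝ) + η * B ^ 2) • (1 : Matrix (Fin d) (Fin d) ℝ)
    + β • ∑ s ∈ Icc 1 (t - 1), outer (g s) (g s)

/-- The quadratic form `vᵀ M v`. -/
def qf {d : ℕ} (M : Matrix (Fin d) (Fin d) ℝ) (v : EuclideanSpace ℝ (Fin d)) : ℝ :=
  ∑ i, ∑ j, v i * M i j * v j

section QuadraticForm

variable {d : ℕ}

theorem qf_add (M N : Matrix (Fin d) (Fin d) ℝ) (v : EuclideanSpace ℝ (Fin d)) :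
    qf (M + N) v = qf M v + qf N v := by
  simp only [qf, Matrix.add_apply, mul_add, add_mul, sum_add_distrib]

theorem qf_smul (c : ℝ) (M : Matrix (Fin d) (Fin d) ℝ) (v : EuclideanSpace ℝ (Fin d)) :
    qf (c • M) v = c * qf M v := by
  simp only [qf, Matrix.smul_apply, smul_eq_mul, mul_sum]
  exact sum_congr rfl fun i _ => sum_congr rfl fun j _ => by ring

theorem qf_sub (M N : Matrix (Fin d) (Fin d) ℝ) (v : EuclideanSpace ℝ (Fin d)) :
    qf (M - N) v = qf M v - qf N v := by
  simp only [qf, Matrix.sub_apply, mul_sub, sub_mul, sum_sub_distrib]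

theorem qf_one (v : EuclideanSpace ℝ (Fin d)) :
    qf (1 : Matrix (Fin d) (Fin d) ℝ) v = ‖v‖ ^ 2 := by
  simp [qf, Matrix.one_apply, EuclideanSpace.real_norm_sq_eq, ← sq]

theorem qf_outer (a v : EuclideanSpace ℝ (Fin d)) : qf (outer a a) v = ⟪a, v⟫_ℝ ^ 2 := by
  simp only [qf, outer, PiLp.inner_apply, RCLike.inner_apply, conj_trivial, sq, sum_mul_sum]
  exact sum_congr rfl fun i _ => sum_congr rfl fun j _ => by ring

theorem qf_sum {ι : Type*} (s : Finset ι) (M : ι → Matrix (Fin d) (Fin d) ℝ)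
    (v : EuclideanSpace ℝ (Fin d)) : qf (∑ i ∈ s, M i) v = ∑ i ∈ s, qf (M i) v := by
  classical
  induction s using Finset.induction_on with
  | empty => simp [qf]
  | insert i s hi ih => rw [sum_insert hi, sum_insert hi, qf_add, ih]

theorem qf_hessPsi (η : ℝ) (x v : EuclideanSpace ℝ (Fin d)) :
    qf (hessPsi d η x) v = 2 * η * d / (1 - ‖x‖ ^ 2) * ‖v‖ ^ 2
      + 4 * η * d / (1 - ‖x‖ ^ 2) ^ 2 * ⟪x, v⟫_ℝ ^ 2 := by
  rw [hessPsi, qf_add, qf_smul, qf_smul, qf_one, qf_outer]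

theorem qf_hessPhi (η β B : ℝ) (g : ℕ → EuclideanSpace ℝ (Fin d)) (t : ℕ)
    (x v : EuclideanSpace ℝ (Fin d)) :
    qf (hessPhi d η β B g t x) v = qf (hessPsi d η x) v + (d + η * B ^ 2) * ‖v‖ ^ 2
      + β * ∑ s ∈ Icc 1 (t - 1), ⟪g s, v⟫_ℝ ^ 2 := by
  simp only [hessPhi, qf_add, qf_smul, qf_one, qf_sum, qf_outer]

theorem posSemidef_of_qf_nonneg {M : Matrix (Fin d) (Fin d) ℝ} (hM : M.IsHermitian)
    (h : ∀ v, 0 ≤ qf M v) : M.PosSemidef := by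
  refine Matrix.PosSemidef.of_dotProduct_mulVec_nonneg hM fun v => ?_
  refine (h (WithLp.toLp 2 v)).trans_eq ?_
  simp only [qf, dotProduct, Matrix.mulVec, mul_sum, Pi.star_apply, star_trivial]
  exact sum_congr rfl fun i _ => sum_congr rfl fun j _ => by ring

theorem isHermitian_outer_self (a : EuclideanSpace ℝ (Fin d)) : (outer a a).IsHermitian := by
  ext i j
  simp [outer, mul_comm]

theorem isHermitian_hessPhi (η β B : ℝ) (g : ℕ → EuclideanSpace ℝ (Fin d)) (t : ℕ)
    (x : EuclideanSpace ℝ (Fin d)) : (hessPhi d η β B g t x).IsHermitian := by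
  have hsum : (∑ s ∈ Icc 1 (t - 1), outer (g s) (g s)).IsHermitian := by
    simp only [Matrix.IsHermitian, Matrix.conjTranspose_sum, (isHermitian_outer_self _).eq]
  simp only [hessPhi, hessPsi, Matrix.IsHermitian, Matrix.conjTranspose_add,
    Matrix.conjTranspose_smul, star_trivial, Matrix.conjTranspose_one, hsum.eq,
    (isHermitian_outer_self x).eq]

end QuadraticForm

/-- The derivative of `Φ_t` along the ray through `x`, i.e. `⟪∇Φ_t(x), x⟫`. -/
theorem hasDerivAt_Phi_smul {d : ℕ} (η β B : ℝ) (g w : ℕ → EuclideanSpace ℝ (Fin d)) (t : ℕ)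
    {x : EuclideanSpace ℝ (Fin d)} (hx : ‖x‖ < 1) :
    HasDerivAt (fun r : ℝ => Phi d η β B g w t (r • x))
      (2 * η * d * ‖x‖ ^ 2 / (1 - ‖x‖ ^ 2) + (d + B ^ 2 * η) * ‖x‖ ^ 2
        + β * ∑ s ∈ Icc 1 (t - 1), ⟪g s, x⟫_ℝ * ⟪g s, x - w s⟫_ℝ
        + ∑ s ∈ Icc 1 (t - 1), ⟪g s, x⟫_ℝ) 1 := by
  have hb : (1 : ℝ) - ‖x‖ ^ 2 ≠ 0 := by nlinarith [norm_nonneg x]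
  have hPhi : (fun r : ℝ => Phi d η β B g w t (r • x)) = fun r : ℝ =>
      -(η * d) * Real.log (1 - r ^ 2 * ‖x‖ ^ 2)
        + ((d + B ^ 2 * η) / 2) * (r ^ 2 * ‖x‖ ^ 2)
        + (β / 2) * ∑ s ∈ Icc 1 (t - 1), (r * ⟪g s, x⟫_ℝ - ⟪g s, w s⟫_ℝ) ^ 2
        + r * ∑ s ∈ Icc 1 (t - 1), ⟪g s, x⟫_ℝ := by
    funext r
    simp only [Phi, Psi, norm_smul, Real.norm_eq_abs, mul_pow, sq_abs, inner_sub_right,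
      real_inner_smul_right, inner_sum, real_inner_comm, mul_sum]
  rw [hPhi]
  have hsq : HasDerivAt (fun r : ℝ => r ^ 2 * ‖x‖ ^ 2) (2 * ‖x‖ ^ 2) 1 := by
    simpa using (hasDerivAt_pow 2 (1 : ℝ)).mul_const (‖x‖ ^ 2)
  have hlog : HasDerivAt (fun r : ℝ => Real.log (1 - r ^ 2 * ‖x‖ ^ 2))
      (-(2 * ‖x‖ ^ 2) / (1 - ‖x‖ ^ 2)) 1 := by
    simpa using (hsq.const_sub 1).log (by simpa using hb)
  have hsum : HasDerivAt
      (fun r : ℝ => ∑ s ∈ Icc 1 (t - 1), (r * ⟪g s, x⟫_ℝ - ⟪g s, w s⟫_ℝ) ^ 2)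
      (∑ s ∈ Icc 1 (t - 1), 2 * (⟪g s, x⟫_ℝ - ⟪g s, w s⟫_ℝ) * ⟪g s, x⟫_ℝ) 1 := by
    refine HasDerivAt.fun_sum fun s _ => ?_
    simpa using (((hasDerivAt_id (1 : ℝ)).mul_const ⟪g s, x⟫_ℝ).sub_const ⟪g s, w s⟫_ℝ).fun_pow 2
  have hlin := (hasDerivAt_id (1 : ℝ)).mul_const (∑ s ∈ Icc 1 (t - 1), ⟪g s, x⟫_ℝ)
  have hs : (β / 2) * ∑ s ∈ Icc 1 (t - 1), 2 * (⟪g s, x⟫_ℝ - ⟪g s, w s⟫_ℝ) * ⟪g s, x⟫_ℝ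
      = β * ∑ s ∈ Icc 1 (t - 1), ⟪g s, x⟫_ℝ * ⟪g s, x - w s⟫_ℝ := by
    rw [mul_sum, mul_sum]
    exact sum_congr rfl fun s _ => by rw [inner_sub_right]; ring
  refine ((((hlog.const_mul (-(η * d))).add (hsq.const_mul ((d + B ^ 2 * η) / 2))).add
    (hsum.const_mul (β / 2))).add hlin).congr_deriv ?_
  rw [hs]
  ring

/-- A minimizer of `Φ_t` over the open unit ball stays away from the sphere. -/
theorem div_one_sub_norm_sq_le_of_isMinOn_Phi {d : ℕ} {η β B : ℝ} (hη : 0 ≤ η) (hβ : 0 ≤ β)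
    (hB : 0 ≤ B) {g w : ℕ → EuclideanSpace ℝ (Fin d)} {t : ℕ}
    (hw : ∀ s ∈ Icc 1 (t - 1), ‖w s‖ ≤ 1) (hg : ∀ s ∈ Icc 1 (t - 1), ‖g s‖ ≤ B)
    {x : EuclideanSpace ℝ (Fin d)} (hx : ‖x‖ < 1)
    (hmin : IsMinOn (Phi d η β B g w t) (Metric.ball 0 1) x) :
    2 * η * d / (1 - ‖x‖ ^ 2) ≤ 2 * η * d + (B + 2 * β * B ^ 2) * (t - 1 : ℕ) := by
  have hmem : ∀ᶠ r : ℝ in nhds 1, r • x ∈ Metric.ball (0 : EuclideanSpace ℝ (Fin d)) 1 := by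
    refine ContinuousAt.eventually_mem (f := fun r : ℝ => r • x) (by fun_prop) ?_
    exact Metric.isOpen_ball.mem_nhds (by simpa using hx)
  have hloc : IsLocalMin (fun r : ℝ => Phi d η β B g w t (r • x)) 1 := by
    filter_upwards [hmem] with r hr
    simpa using hmin hr
  have hzero := hloc.hasDerivAt_eq_zero (hasDerivAt_Phi_smul η β B g w t hx)
  have hb : 0 < 1 - ‖x‖ ^ 2 := by nlinarith [norm_nonneg x]
  have hgx : ∀ s ∈ Icc 1 (t - 1), |⟪g s, x⟫_ℝ| ≤ B := fun s hs =>
    (abs_real_inner_le_norm _ _).trans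
      ((mul_le_mul (hg s hs) hx.le (norm_nonneg _) hB).trans_eq (mul_one B))
  have hgxw : ∀ s ∈ Icc 1 (t - 1), |⟪g s, x - w s⟫_ℝ| ≤ B * 2 := fun s hs =>
    (abs_real_inner_le_norm _ _).trans
      (mul_le_mul (hg s hs) ((norm_sub_le _ _).trans (by linarith [hw s hs]))
        (norm_nonneg _) hB)
  have hprod : -(2 * B ^ 2 * (t - 1 : ℕ)) ≤
      ∑ s ∈ Icc 1 (t - 1), ⟪g s, x⟫_ℝ * ⟪g s, x - w s⟫_ℝ := by
    have := card_nsmul_le_sum (Icc 1 (t - 1)) (fun s => ⟪g s, x⟫_ℝ * ⟪g s, x - w s⟫_ℝ)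
      (-(2 * B ^ 2)) fun s hs => by
        have := mul_le_mul (hgx s hs) (hgxw s hs) (abs_nonneg _) hB
        rw [← abs_mul] at this
        linarith [neg_abs_le (⟪g s, x⟫_ℝ * ⟪g s, x - w s⟫_ℝ)]
    rw [Nat.card_Icc, Nat.add_sub_cancel, nsmul_eq_mul] at this
    linarith
  have hlin : -(B * (t - 1 : ℕ)) ≤ ∑ s ∈ Icc 1 (t - 1), ⟪g s, x⟫_ℝ := by
    have := card_nsmul_le_sum (Icc 1 (t - 1)) (fun s => ⟪g s, x⟫_ℝ) (-B) fun s hs =>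
      neg_le_of_abs_le (hgx s hs)
    rw [Nat.card_Icc, Nat.add_sub_cancel, nsmul_eq_mul] at this
    linarith
  have hsplit : 2 * η * d / (1 - ‖x‖ ^ 2)
      = 2 * η * d + 2 * η * d * ‖x‖ ^ 2 / (1 - ‖x‖ ^ 2) := by
    field_simp
    ring
  have hquad : 0 ≤ (d + B ^ 2 * η) * ‖x‖ ^ 2 := by positivity
  rw [hsplit]
  nlinarith [mul_le_mul_of_nonneg_left hprod hβ]

/-- In a local neighbourhood of `u` for the metric `∇²Ψ(u)`, the distance to the sphere is
controlled by the one of `u`. -/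
theorem one_sub_norm_sq_le_of_qf_hessPsi_le {d : ℕ} (hd : 1 ≤ d) {η C : ℝ} (hη : 0 < η)
    (hC : 0 ≤ C) {u x : EuclideanSpace ℝ (Fin d)} (hu : ‖u‖ < 1)
    (h : qf (hessPsi d η u) (u - x) ≤ η * C ^ 2) :
    1 - ‖x‖ ^ 2 ≤ (1 + C) * (1 - ‖u‖ ^ 2) := by
  have ha : 0 < 1 - ‖u‖ ^ 2 := by nlinarith [norm_nonneg u]
  have hd' : (1 : ℝ) ≤ d := by exact_mod_cast hd
  set p := ⟪u, u - x⟫_ℝ with hp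
  have hxeq : ‖x‖ ^ 2 = ‖u‖ ^ 2 - 2 * p + ‖u - x‖ ^ 2 := by
    rw [hp, norm_sub_sq_real, inner_sub_right, real_inner_self_eq_norm_sq]
    ring
  have hsq : (2 * p) ^ 2 ≤ (C * (1 - ‖u‖ ^ 2)) ^ 2 := by
    have hpos : 0 ≤ 2 * η * d / (1 - ‖u‖ ^ 2) * ‖u - x‖ ^ 2 := by positivity
    have hle : 4 * η * d / (1 - ‖u‖ ^ 2) ^ 2 * p ^ 2 ≤ η * C ^ 2 := by
      rw [qf_hessPsi] at h
      linarith
    rw [div_mul_eq_mul_div, div_le_iff₀ (by positivity)] at hle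
    have hone : η * (4 * p ^ 2) ≤ 4 * η * d * p ^ 2 := by
      nlinarith [mul_nonneg hη.le (sq_nonneg p)]
    have := le_of_mul_le_mul_left (a := η) (b := 4 * p ^ 2)
      (c := C ^ 2 * (1 - ‖u‖ ^ 2) ^ 2) (by linarith) hη
    linarith
  have hple := abs_le_of_sq_le_sq' hsq (by positivity)
  nlinarith [sq_nonneg ‖u - x‖]

/-- Lemma 9 of the paper (Hessian bound): if `x_t` minimizes `Φ_t` over the open unit ball
and `u` in the open unit ball satisfies `(u−x_t)ᵀ∇²Ψ(u)(u−x_t) ≤ ηC²`, then in the Loewner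
order `∇²Φ_t(u) ⪯ 7·(1+C)²·(2ηd + B²η + (B + 2βB²)(t−1))²·I`. -/
theorem hess_Phi_le
    (d : ℕ) (hd : 1 ≤ d) (η β B : ℝ) (hη : 1 ≤ η) (hβ : β ∈ Set.Ioo (0 : ℝ) 1) (hB : 0 < B)
    (T : ℕ) (hT : 1 ≤ T) (g w : ℕ → EuclideanSpace ℝ (Fin d))
    (hw : ∀ s ∈ Icc 1 T, ‖w s‖ < 1)
    (hg : ∀ s ∈ Icc 1 T, ‖g s‖ ≤ B)
    (t : ℕ) (ht : t ∈ Icc 1 (T + 1)) (C : ℝ) (hC : 0 < C)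
    (x : EuclideanSpace ℝ (Fin d))
    (hxball : x ∈ Metric.ball (0 : EuclideanSpace ℝ (Fin d)) 1)
    (hxmin : IsMinOn (Phi d η β B g w t) (Metric.ball (0 : EuclideanSpace ℝ (Fin d)) 1) x)
    (u : EuclideanSpace ℝ (Fin d)) (hu : ‖u‖ < 1)
    (hclose : qf (hessPsi d η u) (u - x) ≤ η * C ^ 2) :
    Matrix.PosSemidef
      ((7 * (1 + C) ^ 2 * (2 * η * d + B ^ 2 * η + (B + 2 * β * B ^ 2) * ((t : ℝ) - 1)) ^ 2) •
          (1 : Matrix (Fin d) (Fin d) ℝ)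
        - hessPhi d η β B g t u) := by
  obtain ⟨ht1, htT⟩ := mem_Icc.mp ht
  have hsub : ∀ s ∈ Icc 1 (t - 1), s ∈ Icc 1 T := fun s hs => by
    simp only [mem_Icc] at hs ⊢
    omega
  have hβ0 := hβ.1
  have hd' : (1 : ℝ) ≤ d := by exact_mod_cast hd
  have hx : ‖x‖ < 1 := by simpa using hxball
  have hmin := div_one_sub_norm_sq_le_of_isMinOn_Phi (by linarith) hβ0.le hB.le
    (fun s hs => (hw s (hsub s hs)).le) (fun s hs => hg s (hsub s hs)) hx hxmin
  have hdist := one_sub_norm_sq_le_of_qf_hessPsi_le hd (by linarith) hC.le hu hclose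
  rw [show (t : ℝ) - 1 = ((t - 1 : ℕ) : ℝ) by push_cast [ht1]; ring]
  refine posSemidef_of_qf_nonneg ?_ fun v => ?_
  · refine Matrix.IsHermitian.sub ?_ (isHermitian_hessPhi η β B g t u)
    simp [Matrix.IsHermitian]
  rw [qf_sub, qf_smul, qf_one, qf_hessPhi, qf_hessPsi]
  have hsum : ∑ s ∈ Icc 1 (t - 1), ⟪g s, v⟫_ℝ ^ 2 ≤ (t - 1 : ℕ) * (B ^ 2 * ‖v‖ ^ 2) := by
    have := sum_le_card_nsmul (Icc 1 (t - 1)) (fun s => ⟪g s, v⟫_ℝ ^ 2) (B ^ 2 * ‖v‖ ^ 2)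
      fun s hs => by
        rw [← mul_pow, ← sq_abs]
        exact pow_le_pow_left₀ (abs_nonneg _) ((abs_real_inner_le_norm _ _).trans
          (mul_le_mul_of_nonneg_right (hg s (hsub s hs)) (norm_nonneg v))) 2
    simpa using this
  have huv : ⟪u, v⟫_ℝ ^ 2 ≤ ‖u‖ ^ 2 * ‖v‖ ^ 2 := by
    rw [← mul_pow, ← sq_abs]
    exact pow_le_pow_left₀ (abs_nonneg _) (abs_real_inner_le_norm _ _) 2
  have ha : 0 < 1 - ‖u‖ ^ 2 := by nlinarith [norm_nonneg u]
  have hb : 0 < 1 - ‖x‖ ^ 2 := by nlinarith [norm_nonneg x]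
  set n : ℝ := ((t - 1 : ℕ) : ℝ) with hn
  have hn0 : 0 ≤ n := Nat.cast_nonneg _
  set a := 1 - ‖u‖ ^ 2 with ha_def
  set b := 1 - ‖x‖ ^ 2
  set S := 2 * η * d + B ^ 2 * η + (B + 2 * β * B ^ 2) * n with hS
  have hL : 2 ≤ 2 * η * d := by nlinarith
  have hBη : 0 ≤ B ^ 2 * η := by positivity
  have hBn : 0 ≤ B * n := by positivity
  have hβn : 0 ≤ β * B ^ 2 * n := by positivity
  have hS2 : 2 ≤ S := by nlinarith
  have hLa : 2 * η * d / a ≤ (1 + C) * S := by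
    rw [div_le_iff₀ hb] at hmin
    rw [div_le_iff₀ ha]
    calc 2 * η * d ≤ (2 * η * d + (B + 2 * β * B ^ 2) * n) * b := hmin
      _ ≤ S * b := mul_le_mul_of_nonneg_right (by linarith) hb.le
      _ ≤ S * ((1 + C) * a) := mul_le_mul_of_nonneg_left hdist (by linarith)
      _ = (1 + C) * S * a := by ring
  have hbarrier : 2 * η * d / a + 4 * η * d / a ^ 2 * ‖u‖ ^ 2 ≤ ((1 + C) * S) ^ 2 := by
    have hua : ‖u‖ ^ 2 = 1 - a := by rw [ha_def]; ring
    have hexp : 2 * η * d / a + 4 * η * d / a ^ 2 * ‖u‖ ^ 2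
        = 2 * (2 * η * d / a ^ 2) - 2 * η * d / a := by
      rw [hua]
      field_simp
      ring
    have hnn : 0 ≤ 2 * η * d / a := by positivity
    have hLa2 : 2 * (2 * η * d / a ^ 2) ≤ (2 * η * d / a) ^ 2 := by
      rw [div_pow, sq (2 * η * d), mul_div_assoc (2 * η * d) (2 * η * d)]
      exact mul_le_mul_of_nonneg_right hL (by positivity)
    have := pow_le_pow_left₀ hnn hLa 2
    linarith
  have hrest : d + η * B ^ 2 + β * B ^ 2 * n ≤ ((1 + C) * S) ^ 2 := by
    have hdη : (d : ℝ) ≤ 2 * η * d := by nlinarith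
    have hle : d + η * B ^ 2 + β * B ^ 2 * n ≤ S := by linarith
    have hSC : S ≤ (1 + C) * S := le_mul_of_one_le_left (by linarith) (by linarith)
    exact (hle.trans hSC).trans (le_self_pow₀ (by linarith) two_ne_zero)
  have hβsum := mul_le_mul_of_nonneg_left hsum hβ0.le
  have huv' := mul_le_mul_of_nonneg_left huv (show 0 ≤ 4 * η * d / a ^ 2 by positivity)
  have hv := sq_nonneg ‖v‖
  have htot := mul_le_mul_of_nonneg_right (add_le_add hbarrier hrest) hv
  linarith [mul_nonneg (sq_nonneg ((1 + C) * S)) hv]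
end
end

section
/- Assume ‖g_t‖ ≤ B for all 1 ≤ t ≤ T, and let x_1,…,x_T ∈ B(1) and w ∈ B(1) be arbitrary. Writing M_t = ∇²Φ_t(w_t), ‖v‖_{M_t} = √(vᵀM_t v) and ‖v‖_{M_t⁻¹} = √(vᵀM_t⁻¹v), the following surrogate-regret decomposition holds: Σ_{t=1}^T ( ⟨w_t − w, g_t⟩ − (β/2)⟨w_t − w, g_t⟩² ) ≤ Σ_{t=1}^T ( ⟨x_t − w, g_t⟩ − (β/2)⟨x_t − w, g_t⟩² ) + (1 + 2βB)·Σ_{t=1}^T ‖w_t − x_t‖_{M_t} · ‖g_t‖_{M_t⁻¹}. -/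
open Finset
open scoped InnerProductSpace

noncomputable section

lemma qf_eq_dotProduct {d : ℕ} (M : Matrix (Fin d) (Fin d) ℝ) (v : EuclideanSpace ℝ (Fin d)) :
    qf M v = v.ofLp ⬝ᵥ (M.mulVec v.ofLp) := by
  simp only [qf, dotProduct, Matrix.mulVec, Finset.mul_sum, mul_assoc]

/-- Cauchy–Schwarz for the pair of dual norms of a positive definite matrix. -/
lemma abs_inner_le_sqrt_qf_mul_sqrt_qf_inv {d : ℕ} {M : Matrix (Fin d) (Fin d) ℝ}
    (hM : M.PosDef) (v g : EuclideanSpace ℝ (Fin d)) :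
    |⟪v, g⟫_ℝ| ≤ Real.sqrt (qf M v) * Real.sqrt (qf M⁻¹ g) := by
  have hnonneg (u : Fin d → ℝ) : 0 ≤ u ⬝ᵥ (M.mulVec u) := by
    simpa using hM.posSemidef.dotProduct_mulVec_nonneg u
  have hsymm : M.transpose = M := by
    simpa [Matrix.IsSymm] using hM.isHermitian
  have hinner : ⟪v, g⟫_ℝ = v.ofLp ⬝ᵥ g.ofLp := by
    simp [EuclideanSpace.inner_eq_star_dotProduct, dotProduct_comm]
  set y := M⁻¹.mulVec g.ofLp with hy
  have hMy : M.mulVec y = g.ofLp := by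
    rw [hy, Matrix.mulVec_mulVec, Matrix.mul_nonsing_inv _ ((Matrix.isUnit_iff_isUnit_det M).mp hM.isUnit),
      Matrix.one_mulVec]
  have hyMv : y ⬝ᵥ (M.mulVec v.ofLp) = v.ofLp ⬝ᵥ g.ofLp := by
    rw [← hMy, Matrix.dotProduct_mulVec, ← Matrix.mulVec_transpose, hsymm, dotProduct_comm]
  have hyg : y ⬝ᵥ g.ofLp = qf M⁻¹ g := by
    rw [qf_eq_dotProduct, dotProduct_comm]
  have hquad (s : ℝ) :
      0 ≤ qf M⁻¹ g * (s * s) + (-2 * (v.ofLp ⬝ᵥ g.ofLp)) * s + qf M v := by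
    have h := hnonneg (v.ofLp - s • y)
    rw [Matrix.mulVec_sub, Matrix.mulVec_smul, hMy, sub_dotProduct, dotProduct_sub,
      dotProduct_sub, smul_dotProduct, smul_dotProduct, dotProduct_smul, dotProduct_smul,
      hyMv, hyg, ← qf_eq_dotProduct] at h
    simp only [smul_eq_mul] at h
    linarith
  have hdisc := discrim_le_zero hquad
  have hv : 0 ≤ qf M v := by rw [qf_eq_dotProduct]; exact hnonneg _
  rw [← Real.sqrt_mul hv, hinner]
  refine Real.abs_le_sqrt ?_
  rw [discrim] at hdisc
  linarith

lemma posSemidef_outer_self {d : ℕ} (v : EuclideanSpace ℝ (Fin d)) : (outer v v).PosSemidef :=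
  Matrix.posSemidef_vecMulVec_self_star v.ofLp

lemma hessPhi_posDef {d : ℕ} (hd : 1 ≤ d) {η β B : ℝ} (hη : 0 ≤ η) (hβ : 0 ≤ β)
    (g : ℕ → EuclideanSpace ℝ (Fin d)) (t : ℕ) {x : EuclideanSpace ℝ (Fin d)} (hx : ‖x‖ < 1) :
    (hessPhi d η β B g t x).PosDef := by
  have hd' : (0 : ℝ) < d := by exact_mod_cast hd
  have hx' : 0 < 1 - ‖x‖ ^ 2 := by nlinarith [norm_nonneg x]
  refine Matrix.PosDef.add_posSemidef (Matrix.PosDef.posSemidef_add ?_ ?_) ?_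
  · exact (Matrix.PosSemidef.one.smul (by positivity)).add
      ((posSemidef_outer_self x).smul (by positivity))
  · exact Matrix.PosDef.one.smul (by positivity)
  · exact (Matrix.posSemidef_sum _ fun s _ => posSemidef_outer_self (g s)).smul hβ

/-- Changing the argument of `a ↦ a − (β/2)a²` within `[-C, C]` costs at most a factor
`1 + βC`. -/
lemma sub_half_mul_sq_le {β C a b : ℝ} (hβ : 0 ≤ β) (ha : |a| ≤ C) (hb : |b| ≤ C) :
    a - β / 2 * a ^ 2 ≤ b - β / 2 * b ^ 2 + (1 + β * C) * |a - b| := by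
  have hab : |a + b| ≤ 2 * C := (abs_add_le a b).trans (by linarith)
  have h : |1 - β / 2 * (a + b)| ≤ 1 + β * C := by
    rw [abs_le] at hab ⊢
    constructor <;> nlinarith
  calc a - β / 2 * a ^ 2
      = b - β / 2 * b ^ 2 + (1 - β / 2 * (a + b)) * (a - b) := by ring
    _ ≤ b - β / 2 * b ^ 2 + (1 + β * C) * |a - b| := by
      refine add_le_add_right ((le_abs_self _).trans ?_) _
      rw [abs_mul]
      gcongr

lemma abs_inner_sub_le {E : Type*} [NormedAddCommGroup E] [InnerProductSpace ℝ E] {B : ℝ}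
    {u v g : E} (hu : ‖u‖ ≤ 1) (hv : ‖v‖ ≤ 1) (hg : ‖g‖ ≤ B) : |⟪u - v, g⟫_ℝ| ≤ 2 * B := by
  have huv : ‖u - v‖ ≤ 2 := (norm_sub_le u v).trans (by linarith)
  exact (abs_real_inner_le_norm _ _).trans (by gcongr)

/-- Surrogate regret decomposition: for arbitrary `x_1,…,x_T ∈ B(1)` and `w ∈ B(1)`, with
`M_t = ∇²Φ_t(w_t)`,
`Σ_t (⟪w_t − w, g_t⟫ − (β/2)⟪w_t − w, g_t⟫²)
  ≤ Σ_t (⟪x_t − w, g_t⟫ − (β/2)⟪x_t − w, g_t⟫²)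
    + (1 + 2βB)·Σ_t ‖w_t − x_t‖_{M_t}·‖g_t‖_{M_t⁻¹}`. -/
theorem surrogate_regret_decomposition
    (d : ℕ) (hd : 1 ≤ d) (η β B : ℝ) (hη : 1 ≤ η) (hβ : β ∈ Set.Ioo (0 : ℝ) 1) (hB : 0 < B)
    (T : ℕ) (hT : 1 ≤ T) (g w : ℕ → EuclideanSpace ℝ (Fin d))
    (hw : ∀ s ∈ Icc 1 T, ‖w s‖ < 1)
    (hg : ∀ s ∈ Icc 1 T, ‖g s‖ ≤ B)
    (x : ℕ → EuclideanSpace ℝ (Fin d)) (hx : ∀ t ∈ Icc 1 T, ‖x t‖ ≤ 1)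
    (w' : EuclideanSpace ℝ (Fin d)) (hw' : ‖w'‖ ≤ 1) :
    ∑ t ∈ Icc 1 T, (⟪w t - w', g t⟫_ℝ - β / 2 * ⟪w t - w', g t⟫_ℝ ^ 2) ≤
      ∑ t ∈ Icc 1 T, (⟪x t - w', g t⟫_ℝ - β / 2 * ⟪x t - w', g t⟫_ℝ ^ 2)
        + (1 + 2 * β * B) *
          ∑ t ∈ Icc 1 T,
            Real.sqrt (qf (hessPhi d η β B g t (w t)) (w t - x t)) *
              Real.sqrt (qf (hessPhi d η β B g t (w t))⁻¹ (g t)) := by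
  rw [Finset.mul_sum, ← Finset.sum_add_distrib]
  refine Finset.sum_le_sum fun t ht => ?_
  have hβ' : 0 ≤ β := hβ.1.le
  refine (sub_half_mul_sq_le hβ' (abs_inner_sub_le (hw t ht).le hw' (hg t ht))
    (abs_inner_sub_le (hx t ht) hw' (hg t ht))).trans ?_
  rw [← inner_sub_left, sub_sub_sub_cancel_right, mul_left_comm β 2 B, ← mul_assoc 2 β B]
  gcongr
  exact abs_inner_le_sqrt_qf_mul_sqrt_qf_inv
    (hessPhi_posDef hd (zero_le_one.trans hη) hβ' g t (hw t ht)) _ _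
end
end
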